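/- Let W : A → B and V : B → C be additive left exact functors between abelian categories with enough injectives, such that W sends injective objects to V-acyclic objects. Then for every bounded-below complex A in A, the composite of derived functors satisfies R(VW)(A) ≅ RV(RW(A)), and there is a convergent Grothendieck spectral sequence E_2^{p,q} = R^pV(R^qW(A)) ⇒ R^{p+q}(VW)(A). -/

import Mathlib

/-!
STATEMENT 7: Let `W : A ⥤ B` and `V : B ⥤ C` be additive left exact functors between abelian
categories with enough injectives, such that `W` sends injective objects to `V`-acyclic
objects. Then for every bounded-below complex `X` in `A`, the composite of derived functors
satisfies `R(VW)(X) ≅ RV(RW(X))`, and there is a convergent Grothendieck spectral sequence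
`E_2^{p,q} = R^pV(R^qW(X)) ⇒ R^{p+q}(VW)(X)`.
-/

open CategoryTheory Limits

/-- A cohomologically-indexed spectral sequence (with pages `E_r` for `r ≥ 2`,
differentials `d_r : E_r^{p,q} → E_r^{p+r, q-r+1}`, each page being the homology of the
previous one) converging to abutment objects `H^n` equipped with a decreasing exhaustive
and separated filtration whose graded pieces are the stable values `E_∞^{p,q}`. -/
structure ConvergingCohomSS (C : Type*) [Category C] [Abelian C] where
  /-- the pages (only `r ≥ 2` is relevant) -/
  E : ℕ → ℤ → ℤ → C
  /-- the differentials `d_r^{p,q} : E_r^{p,q} ⟶ E_r^{p+r, q-r+1}` -/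
  d : ∀ (r : ℕ) (p q p' q' : ℤ), p' = p + r → q' = q - r + 1 → (E r p q ⟶ E r p' q')
  d_comp_d : ∀ (r : ℕ) (p q p' q' p'' q'' : ℤ) (h1 : p' = p + r) (h2 : q' = q - r + 1)
      (h3 : p'' = p' + r) (h4 : q'' = q' - r + 1),
      d r p q p' q' h1 h2 ≫ d r p' q' p'' q'' h3 h4 = 0
  /-- each page is the homology of the previous one -/
  pageIso : ∀ (r : ℕ) (p q : ℤ), Nonempty ((E (r + 1) p q) ≅
      (ShortComplex.mk (d r (p - r) (q + r - 1) p q (by ring) (by ring))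
        (d r p q (p + r) (q - r + 1) rfl rfl)
        (d_comp_d r (p - r) (q + r - 1) p q (p + r) (q - r + 1) (by ring) (by ring)
          rfl rfl)).homology)
  /-- the abutment -/
  H : ℤ → C
  /-- the decreasing filtration `F^j H^n` -/
  filt : (n : ℤ) → ℤ → Subobject (H n)
  filt_antitone : ∀ n : ℤ, Antitone (filt n)
  filt_exhaustive : ∀ n : ℤ, ∃ j : ℤ, filt n j = ⊤
  filt_separated : ∀ n : ℤ, ∃ j : ℤ, filt n j = ⊥
  /-- the pages stabilize at each spot -/
  stabilizes : ∀ p q : ℤ, ∃ r₀ : ℕ, 2 ≤ r₀ ∧ ∀ r : ℕ, r₀ ≤ r → Nonempty (E r p q ≅ E r₀ p q)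
  /-- convergence: the graded pieces `F^j H^n / F^{j+1} H^n` are the stable values
  `E_∞^{j, n-j}` -/
  converges : ∀ n j : ℤ, ∃ r₀ : ℕ, 2 ≤ r₀ ∧
      (∀ r : ℕ, r₀ ≤ r → Nonempty (E r j (n - j) ≅ E r₀ j (n - j))) ∧
      Nonempty (cokernel (Subobject.ofLE (filt n (j + 1)) (filt n j)
        (filt_antitone n (by omega))) ≅ E r₀ j (n - j))


lemma gss_abstract {C Cp D Dp H : Type*} [Category* C] [Category* Cp] [Category* D] [Category* Dp]
    [Category* H] (F : C ⥤ H) (L : C ⥤ D) (W : MorphismProperty C) [L.IsLocalization W]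
    (RF : D ⥤ H) (α : F ⟶ L ⋙ RF) [RF.IsRightDerivedFunctor α W]
    (i : Cp ⥤ C) (Wp : MorphismProperty Cp) (hWp : Wp ≤ W.inverseImage i)
    (Lp : Cp ⥤ Dp) [Lp.IsLocalization Wp]
    (T : C ⥤ Cp) (hT : W ≤ Wp.inverseImage T) (t : 𝟭 C ⟶ T ⋙ i)
    (Rp : Dp ⥤ H) (β : i ⋙ F ⟶ Lp ⋙ Rp) [Rp.IsRightDerivedFunctor β Wp]
    (I : C) [IsIso (t.app I)] [IsIso (β.app (T.obj I))] : IsIso (α.app I) := by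
  have h1 : W.IsInvertedBy (T ⋙ Lp ⋙ Rp) := fun X Y f hf => by
    have := Localization.inverts Lp Wp (T.map f) (hT _ hf)
    dsimp; infer_instance
  have h2 : Wp.IsInvertedBy (i ⋙ L ⋙ RF) := fun X Y f hf => by
    have := Localization.inverts L W (i.map f) (hWp _ hf)
    dsimp; infer_instance
  have h3 : W.IsInvertedBy (T ⋙ i ⋙ L ⋙ RF) := fun X Y f hf => h2 _ (hT _ hf)
  let G := Localization.lift (T ⋙ Lp ⋙ Rp) h1 L
  let eG : L ⋙ G ≅ T ⋙ Lp ⋙ Rp := Localization.fac _ _ _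
  let P := Localization.lift (i ⋙ L ⋙ RF) h2 Lp
  let eP : Lp ⋙ P ≅ i ⋙ L ⋙ RF := Localization.fac _ _ _
  let M := Localization.lift (T ⋙ i ⋙ L ⋙ RF) h3 L
  let eM : L ⋙ M ≅ T ⋙ i ⋙ L ⋙ RF := Localization.fac _ _ _
  let ψ : Rp ⟶ P := Rp.rightDerivedDesc β Wp P (Functor.whiskerLeft i α ≫ eP.inv)
  have hψ : ∀ Z, β.app Z ≫ ψ.app (Lp.obj Z) = α.app (i.obj Z) ≫ eP.inv.app Z :=
    fun Z => Rp.rightDerived_fac_app β Wp P _ Z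
  let bφ : F ⟶ L ⋙ G :=
    { app := fun X => F.map (t.app X) ≫ β.app (T.obj X) ≫ eG.inv.app X
      naturality := fun X Y f => by
        have e1 := t.naturality f
        have e2 := β.naturality (T.map f)
        have e3 := eG.inv.naturality f
        dsimp at e1 e2 e3 ⊢
        rw [Category.assoc, Category.assoc, ← e3, ← reassoc_of% e2, ← F.map_comp_assoc,
          ← F.map_comp_assoc, e1] }
  let φ : RF ⟶ G := RF.rightDerivedDesc α W G bφ
  have hφ : ∀ Z, α.app Z ≫ φ.app (L.obj Z) = F.map (t.app Z) ≫ β.app (T.obj Z) ≫ eG.inv.app Z :=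
    fun Z => RF.rightDerived_fac_app α W G _ Z
  let _ : Localization.Lifting L W (T ⋙ Lp ⋙ Rp) G := ⟨eG⟩
  let _ : Localization.Lifting L W (T ⋙ i ⋙ L ⋙ RF) M := ⟨eM⟩
  let _ : Localization.Lifting L W (L ⋙ RF) RF := ⟨Iso.refl _⟩
  let χ' : T ⋙ Lp ⋙ Rp ⟶ T ⋙ i ⋙ L ⋙ RF :=
    { app := fun X => ψ.app (Lp.obj (T.obj X)) ≫ eP.hom.app (T.obj X)
      naturality := fun X Y f => by
        have e1 := ψ.naturality (Lp.map (T.map f))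
        have e2 := eP.hom.naturality (T.map f)
        dsimp at e1 e2 ⊢
        rw [reassoc_of% e1, e2, Category.assoc] }
  let χ : G ⟶ M := Localization.liftNatTrans L W (T ⋙ Lp ⋙ Rp) (T ⋙ i ⋙ L ⋙ RF) G M χ'
  have hχ : ∀ X, χ.app (L.obj X) = eG.hom.app X ≫ χ'.app X ≫ eM.inv.app X := fun X =>
    Localization.liftNatTrans_app L W (T ⋙ Lp ⋙ Rp) (T ⋙ i ⋙ L ⋙ RF) G M χ' X
  let ξ' : L ⋙ RF ⟶ T ⋙ i ⋙ L ⋙ RF := Functor.whiskerRight t (L ⋙ RF)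
  let ξ : RF ⟶ M := Localization.liftNatTrans L W (L ⋙ RF) (T ⋙ i ⋙ L ⋙ RF) RF M ξ'
  have hξ : ∀ X, ξ.app (L.obj X) = RF.map (L.map (t.app X)) ≫ eM.inv.app X := fun X => by
    refine (Localization.liftNatTrans_app L W (L ⋙ RF) (T ⋙ i ⋙ L ⋙ RF) RF M ξ' X).trans ?_
    exact Category.id_comp _
  have key : φ ≫ χ = ξ := by
    refine RF.rightDerived_ext α W M _ _ ?_
    ext X
    have e1 := hψ (T.obj X)
    have e2 := α.naturality (t.app X)
    dsimp at e1 e2 ⊢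
    rw [reassoc_of% (hφ X), hχ, hξ]
    simp only [Iso.inv_hom_id_app_assoc]
    dsimp [χ']
    rw [Category.assoc, reassoc_of% e1, Iso.inv_hom_id_app_assoc, reassoc_of% e2]
  have k1 : IsIso (φ.app (L.obj I) ≫ χ.app (L.obj I)) := by
    have := congr_app key (L.obj I)
    dsimp at this
    rw [this, hξ]; infer_instance
  have k2 : IsIso (α.app I ≫ φ.app (L.obj I)) := by
    rw [hφ]; infer_instance
  have : IsSplitMono (φ.app (L.obj I)) :=
    ⟨⟨⟨χ.app _ ≫ inv (φ.app (L.obj I) ≫ χ.app (L.obj I)), by rw [← Category.assoc]; simp⟩⟩⟩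
  have : IsSplitEpi (φ.app (L.obj I)) :=
    ⟨⟨⟨inv (α.app I ≫ φ.app (L.obj I)) ≫ α.app I, by rw [Category.assoc]; simp⟩⟩⟩
  have : IsIso (φ.app (L.obj I)) := isIso_of_mono_of_isSplitEpi _
  exact IsIso.of_isIso_comp_right _ (φ.app (L.obj I))

lemma gss_truncGE_isStrictlyGE {A : Type*} [Category* A] [Abelian A] (K : CochainComplex A ℤ)
    (n : ℤ) : (K.truncGE n).IsStrictlyGE n := by infer_instance

lemma gss_isIso_unit {A B : Type*} [Category* A] [Category* B] [Abelian A] [Abelian B]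
    [HasDerivedCategory A] [HasDerivedCategory B] [EnoughInjectives A]
    (F : A ⥤ B) [F.Additive]
    (RF : DerivedCategory A ⥤ DerivedCategory B)
    (α : F.mapHomologicalComplex (ComplexShape.up ℤ) ⋙ DerivedCategory.Q ⟶
      DerivedCategory.Q ⋙ RF)
    [RF.IsRightDerivedFunctor α (HomologicalComplex.quasiIso A (ComplexShape.up ℤ))]
    (I : CochainComplex.Plus (InjectiveObject A)) :
    IsIso (α.app ((InjectiveObject.ι A).mapCochainComplexPlus.obj I).obj) := by
  obtain ⟨n, hn⟩ := ((InjectiveObject.ι A).mapCochainComplexPlus.obj I).property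
  let Fp : CochainComplex.Plus A ⥤ DerivedCategory B :=
    CochainComplex.Plus.ι A ⋙ F.mapHomologicalComplex (ComplexShape.up ℤ) ⋙ DerivedCategory.Q
  have hder : (CochainComplex.Plus.localizerMorphism A).Derives Fp := by
    intro K L f hf
    rw [HomotopyCategory.Plus.inverseImage_quasiIso_mapCochainComplexPlus_injectiveObjectι] at hf
    obtain ⟨e, he⟩ := hf
    have : HomologicalComplex.homotopyEquivalences B (ComplexShape.up ℤ)
        ((F.mapHomologicalComplex (ComplexShape.up ℤ)).map
        (((InjectiveObject.ι A).mapHomologicalComplex (ComplexShape.up ℤ)).map f.hom)) :=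
      ⟨F.mapHomotopyEquiv ((InjectiveObject.ι A).mapHomotopyEquiv e), by
        dsimp [Functor.mapHomotopyEquiv]; rw [he]; rfl⟩
    have := homotopyEquivalences_le_quasiIso _ _ _ this
    exact Localization.inverts DerivedCategory.Q (HomologicalComplex.quasiIso B _) _ this
  have := hder.hasPointwiseRightDerivedFunctor
  let W := CochainComplex.Plus.quasiIso A
  let T : CochainComplex A ℤ ⥤ CochainComplex.Plus A :=
    ObjectProperty.lift _ ((ComplexShape.embeddingUpIntGE n).truncGEFunctor A)
      (fun K => ⟨n, gss_truncGE_isStrictlyGE K n⟩)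
  let t : 𝟭 (CochainComplex A ℤ) ⟶ T ⋙ CochainComplex.Plus.ι A :=
    (ComplexShape.embeddingUpIntGE n).πTruncGENatTrans A
  let J := (InjectiveObject.ι A).mapCochainComplexPlus.obj I
  have ht : IsIso (t.app J.obj) :=
    inferInstanceAs (IsIso (J.obj.πTruncGE n))
  have hT : HomologicalComplex.quasiIso A (ComplexShape.up ℤ) ≤ W.inverseImage T := by
    intro K L f hf
    have hf' : QuasiIso f := hf
    change QuasiIso (CochainComplex.truncGEMap f n)
    rw [CochainComplex.quasiIso_truncGEMap_iff]
    intro i hi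
    infer_instance
  let e : J ≅ T.obj J.obj := ObjectProperty.isoMk _ (asIso (t.app J.obj))
  have h1 : IsIso ((Fp.totalRightDerivedUnit W.Q W).app J) :=
    hder.isIso_of_isRightDerivedFunctor _ I
  have h2 : IsIso ((Fp.totalRightDerivedUnit W.Q W).app (T.obj J.obj)) :=
    (NatTrans.isIso_app_iff_of_iso _ e).1 h1
  exact gss_abstract _ DerivedCategory.Q (HomologicalComplex.quasiIso A (ComplexShape.up ℤ)) RF α
    (CochainComplex.Plus.ι A) W le_rfl W.Q T hT t (Fp.totalRightDerived W.Q W)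
    (Fp.totalRightDerivedUnit W.Q W) _


section
variable (B : Type*) [Category* B] [Abelian B] [HasDerivedCategory B]

/-- The functor from bounded below complexes of injectives up to homotopy. -/
noncomputable abbrev gssE : HomotopyCategory.Plus (InjectiveObject B) ⥤ DerivedCategory.Plus B :=
  (InjectiveObject.ι B).mapHomotopyCategoryPlus ⋙ DerivedCategory.Plus.Qh

lemma gss_isKInj (L : HomotopyCategory.Plus (InjectiveObject B)) :
    CochainComplex.IsKInjective ((InjectiveObject.ι B).mapHomotopyCategoryPlus.obj L).1.as := by
  obtain ⟨L, rfl⟩ := HomotopyCategory.Plus.quotient_obj_surjective L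
  exact inferInstanceAs (CochainComplex.IsKInjective
      (((InjectiveObject.ι B).mapHomologicalComplex (.up ℤ)).obj L.obj))

instance gssE_full : (gssE B).Full where
  map_surjective {K L} f := by
    obtain ⟨g, hg⟩ := (DerivedCategory.Plus.Qh_map_bijective_of_isKInjective _ _
      (gss_isKInj B L)).2 f
    obtain ⟨h, rfl⟩ := (InjectiveObject.ι B).mapHomotopyCategoryPlus.map_surjective g
    exact ⟨h, hg⟩

instance gssE_faithful : (gssE B).Faithful where
  map_injective {K L} f g h := by
    exact (InjectiveObject.ι B).mapHomotopyCategoryPlus.map_injective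
      ((DerivedCategory.Plus.Qh_map_bijective_of_isKInjective _ _
      (gss_isKInj B L)).1 h)

instance gssE_isEquivalence [EnoughInjectives B] : (gssE B).IsEquivalence where

instance gssE_isTriangulated : (gssE B).IsTriangulated := inferInstance

/-- The equivalence. -/
noncomputable def gssEquiv [EnoughInjectives B] :
    HomotopyCategory.Plus (InjectiveObject B) ≌ DerivedCategory.Plus B :=
  (gssE B).asEquivalence

noncomputable instance gssEquiv_commShift [EnoughInjectives B] :
    (gssEquiv B).functor.CommShift ℤ :=
  inferInstanceAs ((gssE B).CommShift ℤ)

instance gssEquiv_triang [EnoughInjectives B] :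
    (gssEquiv B).functor.IsTriangulated :=
  inferInstanceAs ((gssE B).IsTriangulated)

noncomputable instance gssEquiv_inv_commShift [EnoughInjectives B] :
    (gssEquiv B).inverse.CommShift ℤ :=
  (gssEquiv B).commShiftInverse ℤ

instance gssEquiv_inv_triang [EnoughInjectives B] :
    (gssEquiv B).inverse.IsTriangulated := by
  have : (gssEquiv B).CommShift ℤ := (gssEquiv B).commShift_of_functor ℤ
  exact (gssEquiv B).toAdjunction.isTriangulated_rightAdjoint

variable {B} [EnoughInjectives B] {C : Type*} [Category* C] [Abelian C]
  (V : B ⥤ C) [V.Additive]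

/-- Derived functor with values in the homotopy category. -/
noncomputable def gssR : DerivedCategory.Plus B ⥤ HomotopyCategory C (ComplexShape.up ℤ) :=
  (gssEquiv B).inverse ⋙ (InjectiveObject.ι B ⋙ V).mapHomotopyCategoryPlus ⋙
    HomotopyCategory.Plus.ι C

noncomputable instance gssR_commShift : (gssR V).CommShift ℤ := by
  dsimp only [gssR]; infer_instance

instance gssR_triang : (gssR V).IsTriangulated := by
  dsimp only [gssR]; infer_instance

/-- Computation of `gssR` -/
noncomputable def gssRObjIso (J : CochainComplex.Plus (InjectiveObject B)) :
    (gssR V).obj (DerivedCategory.Plus.Q.obj ((InjectiveObject.ι B).mapCochainComplexPlus.obj J)) ≅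
      (HomotopyCategory.quotient C (ComplexShape.up ℤ)).obj
        ((V.mapHomologicalComplex (ComplexShape.up ℤ)).obj
          ((InjectiveObject.ι B).mapCochainComplexPlus.obj J).obj) :=
  ((InjectiveObject.ι B ⋙ V).mapHomotopyCategoryPlus ⋙ HomotopyCategory.Plus.ι C).mapIso
    ((gssEquiv B).unitIso.symm.app ((HomotopyCategory.Plus.quotient _).obj J))
end


section
open Pretriangulated ComposableArrows
variable {D ι C : Type*} [Category* D] [Category* ι] [Category* C] [Abelian C] [HasZeroObject D]
  [HasShift D ℤ] [Preadditive D] [∀ (n : ℤ), (shiftFunctor D n).Additive] [Pretriangulated D]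

/-- Apply a homological functor to a spectral object. -/
noncomputable def gssSO (X : Triangulated.SpectralObject D ι) (F : D ⥤ C) [F.IsHomological]
    [F.ShiftSequence ℤ] : Abelian.SpectralObject C ι where
  H n := X.ω₁ ⋙ F.shift n
  δ' n₀ n₁ h :=
    { app := fun D => F.homologySequenceδ (X.ω₂.obj D) n₀ n₁ h
      naturality := fun D₁ D₂ f =>
        F.homologySequenceδ_naturality _ _ (X.ω₂.map f) n₀ n₁ h }
  exact₁' n₀ n₁ h D :=
    (F.homologySequence_exact₁ _ (X.ω₂_obj_distinguished D) n₀ n₁ h).exact_toComposableArrows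
  exact₂' n D :=
    (F.homologySequence_exact₂ _ (X.ω₂_obj_distinguished D) n).exact_toComposableArrows
  exact₃' n₀ n₁ h D :=
    (F.homologySequence_exact₃ _ (X.ω₂_obj_distinguished D) n₀ n₁ h).exact_toComposableArrows
end

section
variable {B : Type*} [Category* B] [Abelian B] [HasDerivedCategory B]
variable [EnoughInjectives B] {C : Type*} [Category* C] [Abelian C]
  (V : B ⥤ C) [V.Additive]

/-- the spectral object -/
noncomputable def gssX (K : DerivedCategory.Plus B) : Abelian.SpectralObject C EInt :=
  gssSO ((DerivedCategory.Plus.TStructure.t.spectralObject K).mapTriangulatedFunctor (gssR V))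
    (HomotopyCategory.homologyFunctor C (ComplexShape.up ℤ) 0)

/-- hypercohomology -/
noncomputable def gssH (n : ℤ) : DerivedCategory.Plus B ⥤ C :=
  gssR V ⋙ HomotopyCategory.homologyFunctor C (ComplexShape.up ℤ) n

lemma gssX_H_obj (K : DerivedCategory.Plus B) (n : ℤ) (D : ComposableArrows EInt 1) :
  ((gssX V K).H n).obj D = (gssH V n).obj ((DerivedCategory.Plus.TStructure.t.eTruncGE.obj (D.obj 0)).obj ((DerivedCategory.Plus.TStructure.t.eTruncLT.obj (D.obj 1)).obj K)) := rfl
end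


section
variable {C : Type*} [Category* C] [Abelian C]

lemma gss_gr {P Q M N E : C} (k : P ⟶ M) (a : Q ⟶ M) (b : M ⟶ N) (hk : k ≫ b = 0)
    (hex : (ShortComplex.mk k b hk).Exact) (e : Q ⟶ E) (m : E ⟶ N) [Epi e] [Mono m]
    (hem : e ≫ m = a ≫ b) (hle : imageSubobject k ≤ imageSubobject a) :
    Nonempty (cokernel (Subobject.ofLE _ _ hle) ≅ E) := by
  have sq : CommSq e (factorThruImageSubobject a) m ((imageSubobject a).arrow ≫ b) :=
    ⟨by simp [hem]⟩
  have : StrongEpi (factorThruImageSubobject a) := strongEpi_of_epi _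
  let g := sq.lift
  have hg₁ : factorThruImageSubobject a ≫ g = e := sq.fac_left
  have hg₂ : g ≫ m = (imageSubobject a).arrow ≫ b := sq.fac_right
  have : Epi g := epi_of_epi_fac hg₁
  have hz : Subobject.ofLE _ _ hle ≫ g = 0 := by
    rw [← cancel_mono m, ← cancel_epi (factorThruImageSubobject k)]
    simp [hg₂, hk]
  have hS : (ShortComplex.mk _ _ hz).Exact := by
    rw [ShortComplex.exact_iff_exact_up_to_refinements]
    intro A x hx
    dsimp at x hx
    obtain ⟨A', π, hπ, y, hy⟩ := hex.exact_up_to_refinements (x ≫ (imageSubobject a).arrow)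
      (by simp [← hg₂, reassoc_of% hx])
    refine ⟨A', π, hπ, y ≫ factorThruImageSubobject k, ?_⟩
    dsimp at hy
    rw [← cancel_mono (imageSubobject a).arrow]
    simp [hy]
  exact ⟨(cokernelIsCokernel _).coconePointUniqueUpToIso hS.gIsCokernel⟩

open ComposableArrows Abelian.SpectralObject

lemma gss_gr_E {ι : Type*} [Preorder ι] (X : Abelian.SpectralObject C ι) {i₀ i₁ i₂ i₃ : ι}
    (h₁ : i₀ ≤ i₁) (h₂ : i₁ ≤ i₂) (h₃ : i₂ ≤ i₃) (n₀ n₁ n₂ : ℤ) (hn₁ : n₀ + 1 = n₁)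
    (hn₂ : n₁ + 1 = n₂)
    (u : mk₁ (homOfLE h₁) ⟶ mk₁ (homOfLE (h₁.trans (h₂.trans h₃))))
    (v : mk₁ (homOfLE (h₁.trans h₂)) ⟶ mk₁ (homOfLE (h₁.trans (h₂.trans h₃))))
    (hle : imageSubobject ((X.H n₁).map u) ≤ imageSubobject ((X.H n₁).map v)) :
    Nonempty (cokernel (Subobject.ofLE _ _ hle) ≅
      X.E (homOfLE h₁) (homOfLE h₂) (homOfLE h₃) n₀ n₁ n₂ hn₁ hn₂) := by
  obtain rfl : u = twoδ₂Toδ₁ (homOfLE h₁) (homOfLE (h₂.trans h₃)) _ rfl := by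
    ext <;> exact Subsingleton.elim _ _
  refine gss_gr _ _ _ (X.zero₂ (homOfLE h₁) (homOfLE (h₂.trans h₃)) _ rfl n₁) (X.exact₂ (homOfLE h₁) (homOfLE (h₂.trans h₃)) _ rfl n₁)
    (X.toCycles (homOfLE h₁) (homOfLE h₂) (homOfLE (h₁.trans h₂)) rfl n₁ ≫ X.πE _ _ (homOfLE h₃) n₀ n₁ n₂)
    (X.ιE _ _ _ n₀ n₁ n₂ ≫ X.fromOpcycles (homOfLE h₂) (homOfLE h₃) (homOfLE (h₂.trans h₃)) rfl n₁) ?_ hle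
  rw [← Functor.map_comp]
  simp only [Category.assoc, πE_ιE_assoc, toCycles_i_assoc, p_fromOpcycles, ← Functor.map_comp]
  congr 1
end


section
variable {C : Type*} [Category* C] [Abelian C] (X : Abelian.SpectralObject C EInt)
open ComposableArrows Abelian.SpectralObject

/-- comparison map -/
noncomputable def gssφ (b : EInt) : mk₁ (homOfLE (bot_le : (⊥ : EInt) ≤ b)) ⟶
    mk₁ (homOfLE (bot_le : (⊥ : EInt) ≤ ⊤)) :=
  homMk₁ (𝟙 _) (homOfLE le_top) (Subsingleton.elim _ _)

lemma gss_page_iso (r : ℤ) (hr : 2 ≤ r) (p q : ℤ)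
    (h₁ : IsZero ((X.H (p + q + 1)).obj (mk₁ (homOfLE (bot_le : (⊥ : EInt) ≤ (q - r + 2 : ℤ))))))
    (h₂ : IsZero ((X.H (p + q - 1)).obj (mk₁ (homOfLE (le_top : ((q + r - 1 : ℤ) : EInt) ≤ ⊤))))) :
    Nonempty ((X.E₂SpectralSequence.page r hr).X (p, q) ≅
      X.E (homOfLE (bot_le : (⊥ : EInt) ≤ (q : ℤ)))
        (homOfLE (by simp : ((q : ℤ) : EInt) ≤ (q + 1 : ℤ)))
        (homOfLE (le_top : ((q + 1 : ℤ) : EInt) ≤ ⊤)) (p + q - 1) (p + q) (p + q + 1)) := by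
  have e₁ := X.spectralSequencePageXIso coreE₂Cohomological r hr (p, q) _ _ _ _
    rfl rfl rfl rfl (p + q - 1) (p + q) (p + q + 1) rfl
  have i₁ := X.isIso_map_fourδ₁Toδ₀_of_isZero 
    (homOfLE (bot_le : (⊥ : EInt) ≤ (q - r + 2 : ℤ)))
    (homOfLE (by simp; lia : ((q - r + 2 : ℤ) : EInt) ≤ (q : ℤ)))
    (homOfLE (by simp : ((q : ℤ) : EInt) ≤ (q + 1 : ℤ)))
    (homOfLE (by simp; lia : ((q + 1 : ℤ) : EInt) ≤ (q + r - 1 : ℤ)))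
    (homOfLE (bot_le : (⊥ : EInt) ≤ (q : ℤ))) rfl (p + q - 1) (p + q) (p + q + 1) h₁
  have i₂ := X.isIso_map_fourδ₄Toδ₃_of_isZero 
    (homOfLE (bot_le : (⊥ : EInt) ≤ (q : ℤ)))
    (homOfLE (by simp : ((q : ℤ) : EInt) ≤ (q + 1 : ℤ)))
    (homOfLE (by simp; lia : ((q + 1 : ℤ) : EInt) ≤ (q + r - 1 : ℤ)))
    (homOfLE (le_top : ((q + r - 1 : ℤ) : EInt) ≤ ⊤))
    (homOfLE (le_top : ((q + 1 : ℤ) : EInt) ≤ ⊤)) rfl (p + q - 1) (p + q) (p + q + 1) h₂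
  exact ⟨e₁ ≪≫ (@asIso _ _ _ _ _ i₁).symm ≪≫ (@asIso _ _ _ _ _ i₂)⟩

lemma gss_pageIso (r R R' : ℤ) (hr : R = max r 2) (hr' : R' = max (r + 1) 2) (hR : 2 ≤ R)
    (hR' : 2 ≤ R') (a b c : ℤ × ℤ)
    (hab : b = (a.1 + r, a.2 - r + 1)) (hbc : c = (b.1 + r, b.2 - r + 1)) :
    Nonempty ((X.E₂SpectralSequence.page R' hR').X b ≅
      ((X.E₂SpectralSequence.page R hR).sc' a b c).homology) := by
  by_cases h : 2 ≤ r
  · obtain rfl : R = r := by omega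
    refine ⟨(X.E₂SpectralSequence.iso R R' b (by omega) hR).symm ≪≫
      (X.E₂SpectralSequence.page R hR).homologyIsoSc' a b c ?_ ?_⟩
    · apply ComplexShape.prev_eq'
      subst hab
      ext <;> simp <;> lia
    · apply ComplexShape.next_eq'
      subst hbc
      ext <;> simp <;> lia
  · obtain rfl : R' = R := by omega
    have h2 : R' = 2 := by omega
    have z : ∀ (x y : ℤ × ℤ), y = (x.1 + r, x.2 - r + 1) →
        (X.E₂SpectralSequence.page R' hR).d x y = 0 := by
      intro x y hy
      apply HomologicalComplex.shape
      subst hy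
      intro h3
      have h4 := congr_arg Prod.fst h3
      simp at h4
      lia
    exact ⟨(ShortComplex.HomologyData.ofZeros ((X.E₂SpectralSequence.page R' hR).sc' a b c) (z _ _ hab) (z _ _ hbc)).left.homologyIso.symm⟩

lemma gss_gr_aux (n s t q p n' : ℤ) (hs : s = q) (ht : t = q + 1) (hn : n = p + q)
    (hn' : n' = p + q)
    (hle : imageSubobject ((X.H n).map (gssφ (s : ℤ))) ≤
      imageSubobject ((X.H n).map (gssφ (t : ℤ)))) :
    Nonempty (cokernel (Subobject.ofLE _ _ hle) ≅ 
      X.E (homOfLE (bot_le : (⊥ : EInt) ≤ (q : ℤ)))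
        (homOfLE (by simp : ((q : ℤ) : EInt) ≤ (q + 1 : ℤ)))
        (homOfLE (le_top : ((q + 1 : ℤ) : EInt) ≤ ⊤)) (p + q - 1) (p + q) (p + q + 1)) := by
  subst hs ht hn
  exact gss_gr_E X _ _ _ _ _ _ _ _ _ _ hle

lemma gss_anti (n : ℤ) :
    Antitone (fun j : ℤ => imageSubobject ((X.H n).map (gssφ ((n - j + 1 : ℤ) : EInt)))) := by
  intro j j' hj
  have hle : ((n - j' + 1 : ℤ) : EInt) ≤ ((n - j + 1 : ℤ) : EInt) := by simp; lia
  let ψ : mk₁ (homOfLE (bot_le : (⊥ : EInt) ≤ ((n - j' + 1 : ℤ) : EInt))) ⟶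
    mk₁ (homOfLE (bot_le : (⊥ : EInt) ≤ ((n - j + 1 : ℤ) : EInt))) :=
    homMk₁ (𝟙 _) (homOfLE hle) (Subsingleton.elim _ _)
  have : gssφ ((n - j' + 1 : ℤ) : EInt) = ψ ≫ gssφ ((n - j + 1 : ℤ) : EInt) := by
    ext <;> exact Subsingleton.elim _ _
  dsimp only
  rw [this, Functor.map_comp]
  exact imageSubobject_comp_le _ _

/-- the converging spectral sequence of a spectral object -/
noncomputable def gssSS (m : ℤ)
    (h₁ : ∀ n b : ℤ, b ≤ m → IsZero ((X.H n).obj (mk₁ (homOfLE (bot_le : (⊥ : EInt) ≤ (b : ℤ))))))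
    (h₂ : ∀ n b : ℤ, n < b → IsZero ((X.H n).obj (mk₁ (homOfLE (le_top : ((b : ℤ) : EInt) ≤ ⊤))))) :
    ConvergingCohomSS C where
  E r p q := (X.E₂SpectralSequence.page (max (r : ℤ) 2) (le_max_right _ _)).X (p, q)
  d r p q p' q' h h' :=
    (X.E₂SpectralSequence.page (max (r : ℤ) 2) (le_max_right _ _)).d (p, q) (p', q')
  d_comp_d _ _ _ _ _ _ _ _ _ _ _ := HomologicalComplex.d_comp_d _ _ _ _
  pageIso r p q := gss_pageIso X r _ _ rfl (by simp) _ _ _ _ _ (by ext <;> simp <;> ring) (by simp)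
  H n := (X.H n).obj (mk₁ (homOfLE (bot_le : (⊥ : EInt) ≤ ⊤)))
  filt n j := imageSubobject ((X.H n).map (gssφ ((n - j + 1 : ℤ) : EInt)))
  filt_antitone n := gss_anti X n
  filt_exhaustive n := by
    refine ⟨0, ?_⟩
    have := (X.exact₂ (homOfLE (bot_le : (⊥ : EInt) ≤ (n - 0 + 1 : ℤ)))
      (homOfLE (le_top : ((n - 0 + 1 : ℤ) : EInt) ≤ ⊤)) _ rfl n).epi_f
        ((h₂ _ _ (by lia)).eq_of_tgt _ _)
    have h : gssφ ((n - 0 + 1 : ℤ) : EInt) =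
      twoδ₂Toδ₁ _ (homOfLE (le_top : ((n - 0 + 1 : ℤ) : EInt) ≤ ⊤)) _ rfl := by
      ext <;> exact Subsingleton.elim _ _
    rw [h]
    have : Epi ((X.H n).map (twoδ₂Toδ₁ (homOfLE (bot_le : (⊥ : EInt) ≤ (n - 0 + 1 : ℤ)))
      (homOfLE (le_top : ((n - 0 + 1 : ℤ) : EInt) ≤ ⊤)) _ rfl)) := this
    rw [← Subobject.isIso_iff_mk_eq_top]
    have := epi_of_epi_fac (image.fac ((X.H n).map
      (twoδ₂Toδ₁ (homOfLE (bot_le : (⊥ : EInt) ≤ (n - 0 + 1 : ℤ)))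
      (homOfLE (le_top : ((n - 0 + 1 : ℤ) : EInt) ≤ ⊤)) _ rfl)))
    exact isIso_of_mono_of_epi _
  filt_separated n := by
    refine ⟨n + 1 - m, ?_⟩
    rw [(h₁ n (n - (n + 1 - m) + 1) (by lia)).eq_of_src ((X.H n).map (gssφ _)) 0]
    simp
  stabilizes p q := by
    have H : ∀ r : ℕ, max 2 (max (q + 2 - m) (p + 1)).toNat ≤ r → _ := fun r hr =>
      gss_page_iso X (max (r : ℤ) 2) (le_max_right _ _) p q (h₁ _ _ (by lia)) (h₂ _ _ (by lia))
    exact ⟨max 2 (max (q + 2 - m) (p + 1)).toNat, le_max_left _ _, fun r hr =>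
      ⟨(H r hr).some ≪≫ (H _ le_rfl).some.symm⟩⟩
  converges n j := by
    have H : ∀ r : ℕ, max 2 (max (n - j + 2 - m) (j + 1)).toNat ≤ r → _ := fun r hr =>
      gss_page_iso X (max (r : ℤ) 2) (le_max_right _ _) j (n - j) (h₁ _ _ (by lia))
        (h₂ _ _ (by lia))
    refine ⟨max 2 (max (n - j + 2 - m) (j + 1)).toNat, le_max_left _ _, fun r hr =>
      ⟨(H r hr).some ≪≫ (H _ le_rfl).some.symm⟩, ?_⟩
    obtain ⟨e⟩ := gss_gr_aux X n (n - (j + 1) + 1) (n - j + 1) (n - j) j n (by lia) (by lia)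
      (by lia) (by lia) (gss_anti X n (by lia))
    exact ⟨e ≪≫ (H _ le_rfl).some.symm⟩
end


section
variable {B : Type*} [Category* B] [Abelian B] [HasDerivedCategory B]

/-- compatibility of localization functors -/
noncomputable def gssιQ : DerivedCategory.Plus.Q (C := B) ⋙ DerivedCategory.Plus.ι ≅
    CochainComplex.Plus.ι B ⋙ DerivedCategory.Q :=
  Functor.isoWhiskerLeft (CochainComplex.Plus.ι B) (DerivedCategory.quotientCompQhIso B)

lemma gss_isIso_Q {K L : CochainComplex.Plus B} (f : K ⟶ L)
    (hf : CochainComplex.Plus.quasiIso B f) : IsIso (DerivedCategory.Plus.Q.map f) := by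
  have hf' : QuasiIso f.hom := hf
  have : IsIso (DerivedCategory.Plus.ι.map (DerivedCategory.Plus.Q.map f)) :=
    ((MorphismProperty.isomorphisms _).arrow_mk_iso_iff
      (((Functor.mapArrowFunctor _ _).mapIso (gssιQ (B := B))).app (Arrow.mk f))).2
      (inferInstanceAs (IsIso (DerivedCategory.Q.map f.hom)))
  exact isIso_of_fully_faithful DerivedCategory.Plus.ι _

lemma gss_repr [EnoughInjectives B] (L : DerivedCategory.Plus B) (b : ℤ) [L.IsGE b] :
    ∃ (J : CochainComplex.Plus (InjectiveObject B)), J.obj.IsStrictlyGE b ∧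
      Nonempty (L ≅ DerivedCategory.Plus.Q.obj
        ((InjectiveObject.ι B).mapCochainComplexPlus.obj J)) := by
  obtain ⟨K, hK, ⟨e⟩⟩ := (DerivedCategory.Plus.ι.obj L).exists_iso_Q_obj_of_isGE b
  let K' : CochainComplex.Plus B := ⟨K, b, hK⟩
  have : K'.obj.IsStrictlyGE b := hK
  obtain ⟨J, hJ, i, hi⟩ := CochainComplex.Plus.exists_quasiIso_injective K' b
  have := gss_isIso_Q i hi
  exact ⟨J, hJ, ⟨DerivedCategory.Plus.ι.preimageIso (e ≪≫ (gssιQ.symm.app K')) ≪≫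
    asIso (DerivedCategory.Plus.Q.map i)⟩⟩

variable [EnoughInjectives B] {C : Type*} [Category* C] [Abelian C]
  (V : B ⥤ C) [V.Additive]

instance gssH_additive (n : ℤ) : (gssH V n).Additive := by
  dsimp only [gssH]; infer_instance

/-- hypercohomology of an injective complex -/
noncomputable def gssHObjIso (J : CochainComplex.Plus (InjectiveObject B)) (n : ℤ) :
    (gssH V n).obj (DerivedCategory.Plus.Q.obj ((InjectiveObject.ι B).mapCochainComplexPlus.obj J)) ≅
      ((V.mapHomologicalComplex (ComplexShape.up ℤ)).obj
          ((InjectiveObject.ι B).mapCochainComplexPlus.obj J).obj).homology n :=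
  (HomotopyCategory.homologyFunctor C (ComplexShape.up ℤ) n).mapIso (gssRObjIso V J) ≪≫
    (HomotopyCategory.homologyFunctorFactors C (ComplexShape.up ℤ) n).app _

lemma gssH_isZero (L : DerivedCategory.Plus B) (n b : ℤ) [L.IsGE b] (h : n < b) :
    IsZero ((gssH V n).obj L) := by
  obtain ⟨J, hJ, ⟨e⟩⟩ := gss_repr L b
  refine IsZero.of_iso ?_ ((gssH V n).mapIso e ≪≫ gssHObjIso V J n)
  have h1 : IsZero (J.obj.X n) := J.obj.isZero_of_isStrictlyGE b n h
  refine ShortComplex.isZero_homology_of_isZero_X₂ _ ?_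
  exact V.map_isZero ((InjectiveObject.ι B).map_isZero h1)

/-- shift -/
noncomputable def gssHShift (L : DerivedCategory.Plus B) (a n n' : ℤ) (h : a + n = n') :
    (gssH V n).obj (L⟦a⟧) ≅ (gssH V n').obj L :=
  (HomotopyCategory.homologyFunctor C (ComplexShape.up ℤ) n).mapIso
    (((gssR V).commShiftIso a).app L) ≪≫
    ((HomotopyCategory.homologyFunctor C (ComplexShape.up ℤ) 0).shiftIso a n n' h).app _

/-- injective resolution as a bounded below complex -/
noncomputable def gssRes {M : B} (R : InjectiveResolution M) :
    CochainComplex.Plus (InjectiveObject B) :=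
  ⟨{ X := fun n => ⟨R.cochainComplex.X n, inferInstance⟩
     d := fun i j => ObjectProperty.homMk (R.cochainComplex.d i j)
     shape := fun i j h => by ext; exact R.cochainComplex.shape i j h
     d_comp_d' := fun i j k _ _ => by ext; exact R.cochainComplex.d_comp_d i j k }, 0, by
      rw [CochainComplex.isStrictlyGE_iff]
      intro i hi
      have : IsZero (R.cochainComplex.X i) := R.cochainComplex.isZero_of_isStrictlyGE 0 i hi
      rw [IsZero.iff_id_eq_zero] at this ⊢
      ext
      exact this⟩

noncomputable def gssResIso {M : B} (R : InjectiveResolution M) :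
  ((InjectiveObject.ι B).mapCochainComplexPlus.obj (gssRes R)).obj ≅ R.cochainComplex :=
  Iso.refl _

end


section
variable {B : Type*} [Category* B] [Abelian B] 
variable {C : Type*} [Category* C] [Abelian C]
  (V : B ⥤ C) [V.Additive]

lemma gssExt_aux {X Y X' Y' : B} {Z Z' : C} (a : X ≅ Y) (b : X' ≅ Y') (c : Z ≅ V.obj Y)
    (c' : Z' ≅ V.obj Y') (d : Y ⟶ Y') :
    (V.mapIso a ≪≫ c.symm).hom ≫ (c.hom ≫ V.map d ≫ c'.inv) =
    V.map (a.hom ≫ d ≫ b.inv) ≫ (V.mapIso b ≪≫ c'.symm).hom := by simp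

/-- components -/
noncomputable def gssExtX (K : CochainComplex B ℕ) : (i : ℤ) →
    (V.obj ((K.extend ComplexShape.embeddingUpNat).X i) ≅
    (((V.mapHomologicalComplex (ComplexShape.up ℕ)).obj K).extend
      ComplexShape.embeddingUpNat).X i)
  | Int.ofNat k => V.mapIso (HomologicalComplex.extendXIso K ComplexShape.embeddingUpNat
      (i := k) rfl) ≪≫
      (HomologicalComplex.extendXIso ((V.mapHomologicalComplex (ComplexShape.up ℕ)).obj K)
        ComplexShape.embeddingUpNat (i := k) rfl).symm
  | Int.negSucc k => IsZero.iso
      (V.map_isZero (HomologicalComplex.isZero_extend_X _ _ _ (by intro i; simp)))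
      (HomologicalComplex.isZero_extend_X _ _ _ (by intro i; simp))

/-- additive functors commute with extension -/
noncomputable def gssExt (K : CochainComplex B ℕ) :
    (V.mapHomologicalComplex (ComplexShape.up ℤ)).obj (K.extend ComplexShape.embeddingUpNat) ≅
    ((V.mapHomologicalComplex (ComplexShape.up ℕ)).obj K).extend ComplexShape.embeddingUpNat :=
  HomologicalComplex.Hom.isoOfComponents (gssExtX V K) (by
    rintro (i | i) (j | j) _
    · have h1 := HomologicalComplex.extend_d_eq K ComplexShape.embeddingUpNat
        (i := i) (j := j) (i' := Int.ofNat i) (j' := Int.ofNat j) rfl rfl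
      have h2 := HomologicalComplex.extend_d_eq
        ((V.mapHomologicalComplex (ComplexShape.up ℕ)).obj K) ComplexShape.embeddingUpNat
        (i := i) (j := j) (i' := Int.ofNat i) (j' := Int.ofNat j) rfl rfl
      change (gssExtX V K (Int.ofNat i)).hom ≫ _ = V.map _ ≫ (gssExtX V K (Int.ofNat j)).hom
      refine (congrArg (fun z => (gssExtX V K (Int.ofNat i)).hom ≫ z) h2).trans
        (Eq.trans ?_ (congrArg (fun z => V.map z ≫ (gssExtX V K (Int.ofNat j)).hom) h1).symm)
      exact gssExt_aux V _ _ _ _ _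
    · exact (HomologicalComplex.isZero_extend_X _ _ _ (by intro i; simp)).eq_of_tgt _ _
    · exact (V.map_isZero (HomologicalComplex.isZero_extend_X _ _ _ (by intro i; simp))).eq_of_src _ _
    · exact (V.map_isZero (HomologicalComplex.isZero_extend_X _ _ _ (by intro i; simp))).eq_of_src _ _)

variable [HasDerivedCategory B] [EnoughInjectives B]

lemma gssH_single_zero (M : B) (p : ℕ) :
    Nonempty ((gssH V p).obj ((DerivedCategory.Plus.singleFunctor B 0).obj M) ≅
      (V.rightDerived p).obj M) := by
  let R := (InjectiveResolution.of M)
  let K' : CochainComplex.Plus B := ⟨(CochainComplex.singleFunctor B 0).obj M, 0, inferInstance⟩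
  let i : K' ⟶ (InjectiveObject.ι B).mapCochainComplexPlus.obj (gssRes R) :=
    ObjectProperty.homMk R.ι'
  have hi : CochainComplex.Plus.quasiIso B i := inferInstanceAs (QuasiIso R.ι')
  have := gss_isIso_Q i hi
  let e : (DerivedCategory.Plus.singleFunctor B 0).obj M ≅
    DerivedCategory.Plus.Q.obj ((InjectiveObject.ι B).mapCochainComplexPlus.obj (gssRes R)) :=
    DerivedCategory.Plus.ι.preimageIso ((DerivedCategory.singleFunctorIsoCompQ B 0).app M ≪≫ 
      (gssιQ.symm.app K')) ≪≫
    asIso (DerivedCategory.Plus.Q.map i)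
  refine ⟨(gssH V p).mapIso e ≪≫ gssHObjIso V _ _ ≪≫ ?_ ≪≫ (R.isoRightDerivedObj V p).symm⟩
  exact (HomologicalComplex.homologyFunctor _ _ _).mapIso (gssExt V R.cocomplex) ≪≫
    HomologicalComplex.extendHomologyIso _ ComplexShape.embeddingUpNat (j := p) rfl

lemma gssH_single (M : B) (p : ℕ) (n q : ℤ) (h : p + q = n) :
    Nonempty ((gssH V n).obj ((DerivedCategory.Plus.singleFunctor B q).obj M) ≅
      (V.rightDerived p).obj M) := by
  obtain ⟨e⟩ := gssH_single_zero V M p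
  refine ⟨(gssHShift V _ q p n (by lia)).symm ≪≫ (gssH V p).mapIso
    (((DerivedCategory.Plus.singleFunctors B).shiftIso q 0 q (by lia)).app M) ≪≫ e⟩

end


section
open Pretriangulated
variable {B : Type*} [Category* B] [Abelian B] [HasDerivedCategory B]

lemma gss_iso₁₂ (T : Triangle (DerivedCategory B)) (hT : T ∈ distTriang _) (n₀ n₁ : ℤ)
    (h : n₀ + 1 = n₁) (h0 : IsZero ((DerivedCategory.homologyFunctor B n₀).obj T.obj₃))
    (h1 : IsZero ((DerivedCategory.homologyFunctor B n₁).obj T.obj₃)) :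
    IsIso ((DerivedCategory.homologyFunctor B n₁).map T.mor₁) := by
  have := (DerivedCategory.HomologySequence.epi_homologyMap_mor₁_iff T hT n₁).2 (h1.eq_of_tgt _ _)
  have := (DerivedCategory.HomologySequence.mono_homologyMap_mor₁_iff T hT n₀ n₁ h).2
    (h0.eq_of_src _ _)
  exact isIso_of_mono_of_epi _

lemma gss_iso₂₃ (T : Triangle (DerivedCategory B)) (hT : T ∈ distTriang _) (n₀ n₁ : ℤ)
    (h : n₀ + 1 = n₁) (h0 : IsZero ((DerivedCategory.homologyFunctor B n₀).obj T.obj₁))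
    (h1 : IsZero ((DerivedCategory.homologyFunctor B n₁).obj T.obj₁)) :
    IsIso ((DerivedCategory.homologyFunctor B n₀).map T.mor₂) := by
  have := (DerivedCategory.HomologySequence.mono_homologyMap_mor₂_iff T hT n₀).2 (h0.eq_of_src _ _)
  have := (DerivedCategory.HomologySequence.epi_homologyMap_mor₂_iff T hT n₀ n₁ h).2
    (h1.eq_of_tgt _ _)
  exact isIso_of_mono_of_epi _

lemma gss_heart (L : DerivedCategory.Plus B) (q : ℤ) [L.IsGE q] [L.IsLE q] :
    Nonempty (L ≅ (DerivedCategory.Plus.singleFunctor B q).obj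
      ((DerivedCategory.Plus.homologyFunctor B q).obj L)) := by
  obtain ⟨Y, ⟨e⟩⟩ := DerivedCategory.exists_iso_singleFunctor_obj_of_isGE_of_isLE
    (DerivedCategory.Plus.ι.obj L) q
  let e' : (DerivedCategory.Plus.homologyFunctor B q).obj L ≅ Y :=
    (DerivedCategory.homologyFunctor B q).mapIso (e ≪≫ 
      (DerivedCategory.singleFunctorIsoCompQ B q).app Y) ≪≫
      (DerivedCategory.homologyFunctorFactors B q).app _ ≪≫
      (HomologicalComplex.homologyFunctorSingleIso B (ComplexShape.up ℤ) q).app Y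
  let e'' : L ≅ (DerivedCategory.Plus.singleFunctor B q).obj Y :=
    DerivedCategory.Plus.ι.preimageIso e
  exact ⟨e'' ≪≫ (DerivedCategory.Plus.singleFunctor B q).mapIso e'.symm⟩

open DerivedCategory.Plus.TStructure

lemma gss_trunc (K : DerivedCategory.Plus B) (q : ℤ) :
    Nonempty ((t.eTruncGE.obj (q : EInt)).obj ((t.eTruncLT.obj ((q + 1 : ℤ) : EInt)).obj K) ≅
      (DerivedCategory.Plus.singleFunctor B q).obj
      ((DerivedCategory.Plus.homologyFunctor B q).obj K)) := by
  let L := (t.eTruncLT.obj ((q + 1 : ℤ) : EInt)).obj K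
  let M := (t.eTruncGE.obj (q : EInt)).obj L
  have hL : L.IsLE q := t.isLE_eTruncLT_obj_obj q _ le_rfl K
  have hM : M.IsLE q := inferInstanceAs (t.IsLE ((t.eTruncGE.obj (q : EInt)).obj L) q)
  have hM' : M.IsGE q := t.isGE_eTruncGE_obj_obj q _ le_rfl L
  obtain ⟨e⟩ := gss_heart M q
  have h1 := gss_iso₁₂ _ (DerivedCategory.Plus.ι.map_distinguished _
    (t.eTriangleLTGE_distinguished ((q + 1 : ℤ) : EInt) K)) (q - 1) q (by lia)
    (by
      have : DerivedCategory.Plus.IsGE ((t.eTruncGE.obj ((q + 1 : ℤ) : EInt)).obj K) (q+1) :=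
        t.isGE_eTruncGE_obj_obj (q + 1) _ le_rfl K
      exact DerivedCategory.Plus.isZero_homology_of_isGE ((t.eTruncGE.obj ((q + 1 : ℤ) : EInt)).obj K) (q + 1) _ (by lia))
    (by
      have : DerivedCategory.Plus.IsGE ((t.eTruncGE.obj ((q + 1 : ℤ) : EInt)).obj K) (q+1) :=
        t.isGE_eTruncGE_obj_obj (q + 1) _ le_rfl K
      exact DerivedCategory.Plus.isZero_homology_of_isGE ((t.eTruncGE.obj ((q + 1 : ℤ) : EInt)).obj K) (q + 1) _ (by lia))
  have h2 := gss_iso₂₃ _ (DerivedCategory.Plus.ι.map_distinguished _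
    (t.eTriangleLTGE_distinguished (q : EInt) L)) q (q + 1) (by lia)
    (by
      have : DerivedCategory.Plus.IsLE ((t.eTruncLT.obj (q : EInt)).obj L) (q - 1) :=
        t.isLE_eTruncLT_obj_obj (q - 1) _ (by simp) L
      exact DerivedCategory.Plus.isZero_homology_of_isLE ((t.eTruncLT.obj (q : EInt)).obj L) (q - 1) _ (by lia))
    (by
      have : DerivedCategory.Plus.IsLE ((t.eTruncLT.obj (q : EInt)).obj L) (q - 1) :=
        t.isLE_eTruncLT_obj_obj (q - 1) _ (by simp) L
      exact DerivedCategory.Plus.isZero_homology_of_isLE ((t.eTruncLT.obj (q : EInt)).obj L) (q - 1) _ (by lia))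
  let e1 : (DerivedCategory.Plus.homologyFunctor B q).obj L ≅
    (DerivedCategory.Plus.homologyFunctor B q).obj K := @asIso _ _ _ _ _ h1
  let e2 : (DerivedCategory.Plus.homologyFunctor B q).obj L ≅
    (DerivedCategory.Plus.homologyFunctor B q).obj M := @asIso _ _ _ _ _ h2
  exact ⟨e ≪≫ (DerivedCategory.Plus.singleFunctor B q).mapIso (e2.symm ≪≫ e1)⟩

variable [EnoughInjectives B] {C : Type*} [Category* C] [Abelian C]
  (V : B ⥤ C) [V.Additive]

lemma gss_final (K : DerivedCategory.Plus B) (m : ℤ) [K.IsGE m] :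
    ∃ S : ConvergingCohomSS C,
      (∀ p q : ℤ, 0 ≤ p → Nonempty (S.E 2 p q ≅
        (V.rightDerived p.toNat).obj ((DerivedCategory.Plus.homologyFunctor B q).obj K))) ∧
      (∀ p q : ℤ, p < 0 → IsZero (S.E 2 p q)) ∧
      (∀ n : ℤ, Nonempty (S.H n ≅ (gssH V n).obj K)) := by
  have H : ∀ p q : ℤ, Nonempty (((gssX V K).E₂SpectralSequence.page 2 le_rfl).X (p, q) ≅
      ((gssX V K).H (p + q)).obj (ComposableArrows.mk₁ (homOfLE
        (by simp : ((q : ℤ) : EInt) ≤ ((q + 1 : ℤ) : EInt))))) := fun p q =>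
    ⟨(gssX V K).spectralSequenceFirstPageXIso Abelian.SpectralObject.coreE₂Cohomological
      (p, q) _ _ rfl rfl _ rfl⟩
  refine ⟨gssSS (gssX V K) m ?_ ?_, ?_, ?_, ?_⟩
  · intro n b hb
    rw [gssX_H_obj]
    apply Functor.map_isZero
    exact t.isZero_eTruncLT_obj_obj K m (b : EInt) (by simpa using hb)
  · intro n b hb
    rw [gssX_H_obj]
    have : DerivedCategory.Plus.IsGE ((t.eTruncGE.obj (b : EInt)).obj K) b :=
        t.isGE_eTruncGE_obj_obj b _ le_rfl K
    exact gssH_isZero V ((t.eTruncGE.obj (b : EInt)).obj K) n b hb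
  · intro p q hp
    obtain ⟨e⟩ := H p q
    obtain ⟨e1⟩ := gss_trunc K q
    obtain ⟨e2⟩ := gssH_single V ((DerivedCategory.Plus.homologyFunctor B q).obj K) p.toNat
      (p + q) q (by lia)
    exact ⟨e ≪≫ (gssH V (p + q)).mapIso e1 ≪≫ e2⟩
  · intro p q hp
    obtain ⟨e⟩ := H p q
    refine IsZero.of_iso ?_ e
    rw [gssX_H_obj]
    have : DerivedCategory.Plus.IsGE ((t.eTruncGE.obj (q : EInt)).obj
      ((t.eTruncLT.obj ((q + 1 : ℤ) : EInt)).obj K)) q := t.isGE_eTruncGE_obj_obj q _ le_rfl _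
    exact gssH_isZero V ((t.eTruncGE.obj (q : EInt)).obj
      ((t.eTruncLT.obj ((q + 1 : ℤ) : EInt)).obj K)) (p + q) q (by lia)
  · intro n
    exact ⟨Iso.refl _⟩
end


section
open Pretriangulated
variable {B : Type*} [Category* B] [Abelian B] [HasDerivedCategory B]

lemma gss_ses (S : ShortComplex B) (hS : S.ShortExact) :
    ∃ h, Triangle.mk ((DerivedCategory.Plus.singleFunctor B 0).map S.f)
      ((DerivedCategory.Plus.singleFunctor B 0).map S.g) h ∈
        distTriang (DerivedCategory.Plus B) := by
  let c := (DerivedCategory.Plus.ι (C := B)).commShiftIso (1 : ℤ)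
  let X₁ := (DerivedCategory.Plus.singleFunctor B 0).obj S.X₁
  let X₃ := (DerivedCategory.Plus.singleFunctor B 0).obj S.X₃
  let δ : DerivedCategory.Plus.ι.obj X₃ ⟶ (DerivedCategory.Plus.ι.obj X₁)⟦(1 : ℤ)⟧ := hS.singleδ
  let h : X₃ ⟶ X₁⟦(1 : ℤ)⟧ := DerivedCategory.Plus.ι.preimage (δ ≫ c.inv.app X₁)
  have hh : DerivedCategory.Plus.ι.map h ≫ c.hom.app X₁ = δ := by
    rw [Functor.map_preimage, Category.assoc, c.inv_hom_id_app]
    exact Category.comp_id _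
  refine ⟨h, ?_⟩
  refine isomorphic_distinguished _ hS.singleTriangle_distinguished _ ?_
  refine Triangle.isoMk _ _ (Iso.refl _) (Iso.refl _) (Iso.refl _) ?_ ?_ ?_
  · exact (Category.comp_id _).trans (Category.id_comp _).symm
  · exact (Category.comp_id _).trans (Category.id_comp _).symm
  · refine Eq.trans (congrArg (fun z => _ ≫ z) ((shiftFunctor (DerivedCategory B) (1 : ℤ)).map_id _)) ?_
    exact (Category.comp_id _).trans (hh.trans (Category.id_comp _).symm)

variable [EnoughInjectives B] {C : Type*} [Category* C] [Abelian C]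
  (V : B ⥤ C) [V.Additive]

lemma gss_dimshift (S : ShortComplex B) (hS : S.ShortExact) (q : ℕ)
    (h₂ : IsZero ((V.rightDerived q).obj S.X₂)) (h₁ : IsZero ((V.rightDerived (q + 1)).obj S.X₁)) :
    IsZero ((V.rightDerived q).obj S.X₃) := by
  obtain ⟨e₁⟩ := gssH_single_zero V S.X₁ (q + 1)
  obtain ⟨e₂⟩ := gssH_single_zero V S.X₂ q
  obtain ⟨e₃⟩ := gssH_single_zero V S.X₃ q
  obtain ⟨h, hT⟩ := gss_ses S hS
  have ex := (HomotopyCategory.homologyFunctor C (ComplexShape.up ℤ) 0).homologySequence_exact₃ _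
    ((gssR V).map_distinguished _ hT) (q : ℤ) ((q + 1 : ℕ) : ℤ) (by simp)
  refine IsZero.of_iso ?_ e₃.symm
  have := ex.isZero_of_both_zeros ((h₂.of_iso e₂).eq_of_src _ _) ((h₁.of_iso e₁).eq_of_tgt _ _)
  exact this
end

section
variable {B : Type*} [Category* B] [Abelian B] 
variable [EnoughInjectives B] {C : Type*} [Category* C] [Abelian C]
  (V : B ⥤ C) [V.Additive] [PreservesFiniteLimits V]

lemma gss_pb {Z N Z' I J : B} (f : Z ⟶ N) (g : N ⟶ Z') (w : f ≫ g = 0)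
    (hS : (ShortComplex.mk f g w).ShortExact) (i : Z ⟶ I) (d : I ⟶ J) (w' : i ≫ d = 0)
    (hi : (ShortComplex.mk i d w').Exact) (hi' : Mono i) (a : N ⟶ I) (b : Z' ⟶ J)
    (ha : f ≫ a = i) (hb : g ≫ b = a ≫ d) : IsPullback a g d b := by
  have hf : Mono f := hS.mono_f
  have hg : Epi g := hS.epi_g
  obtain ⟨φ, hφ₁, hφ₂⟩ : ∃ φ : N ⟶ pullback d b, φ ≫ pullback.fst d b = a ∧
      φ ≫ pullback.snd d b = g :=
    ⟨pullback.lift a g hb.symm, pullback.lift_fst _ _ _, pullback.lift_snd _ _ _⟩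
  have h1 : Mono φ := by
    refine Preadditive.mono_of_cancel_zero _ fun {T} x hx => ?_
    have h2 : x ≫ g = 0 := by simpa [hφ₁, hφ₂] using congrArg (· ≫ pullback.snd d b) hx
    have h3 : x ≫ a = 0 := by simpa [hφ₁, hφ₂] using congrArg (· ≫ pullback.fst d b) hx
    obtain ⟨y, rfl⟩ : ∃ y, y ≫ f = x := ⟨hS.exact.lift x h2, hS.exact.lift_f x h2⟩
    rw [Category.assoc, ha] at h3
    have : y = 0 := by rw [← cancel_mono i, h3, zero_comp]
    simp [this]
  have h2 : Epi φ := by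
    rw [epi_iff_surjective_up_to_refinements]
    intro T y
    obtain ⟨T', π, hπ, n, hn⟩ := surjective_up_to_refinements_of_epi g (y ≫ pullback.snd d b)
    have h0 : (π ≫ y ≫ pullback.fst d b - n ≫ a) ≫ d = 0 := by
      rw [Preadditive.sub_comp, Category.assoc, Category.assoc, Category.assoc, ← hb,
        pullback.condition, ← Category.assoc n, ← hn]
      simp
    let k := hi.lift _ h0
    have hk : k ≫ i = _ := hi.lift_f _ h0
    refine ⟨T', π, hπ, n + k ≫ f, ?_⟩
    apply pullback.hom_ext
    · simp [hφ₁, ha, hk]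
    · simp [hφ₂, w, hn]
  have : IsIso φ := isIso_of_mono_of_epi _
  exact IsPullback.of_iso_pullback ⟨hb.symm⟩ (asIso φ) (by simp [hφ₁, hφ₂]) (by simp [hφ₁, hφ₂])

lemma gss_epi (S : ShortComplex B) (hS : S.ShortExact)
    (h : IsZero ((V.rightDerived 1).obj S.X₁)) : Epi (V.map S.g) := by
  let R := InjectiveResolution.of S.X₁
  have hf : Mono S.f := hS.mono_f
  have hg : Epi S.g := hS.epi_g
  let i : S.X₁ ⟶ R.cocomplex.X 0 := R.ι.f 0
  have hi : Mono i := inferInstanceAs (Mono (R.ι.f 0))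
  let a : S.X₂ ⟶ R.cocomplex.X 0 := Injective.factorThru i S.f
  have ha : S.f ≫ a = i := Injective.comp_factorThru _ _
  have hid : i ≫ R.cocomplex.d 0 1 = 0 := R.ι_f_zero_comp_complex_d
  have h0 : S.f ≫ (a ≫ R.cocomplex.d 0 1) = 0 := by rw [← Category.assoc, ha, hid]
  let b : S.X₃ ⟶ R.cocomplex.X 1 := hS.exact.desc _ h0
  have hb : S.g ≫ b = a ≫ R.cocomplex.d 0 1 := hS.exact.g_desc _ h0
  have hbd : b ≫ R.cocomplex.d 1 2 = 0 := by
    rw [← cancel_epi S.g, ← Category.assoc, hb]; simp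
  have pb := (gss_pb S.f S.g S.zero hS i (R.cocomplex.d 0 1) hid R.exact₀ hi a b ha hb).map V
  have ex : (((V.mapHomologicalComplex _).obj R.cocomplex).sc' 0 1 2).Exact := by
    rw [← HomologicalComplex.exactAt_iff' _ 0 1 2 (by simp) (by simp),
      HomologicalComplex.exactAt_iff_isZero_homology]
    exact h.of_iso (R.isoRightDerivedObj V 1).symm
  rw [epi_iff_surjective_up_to_refinements]
  intro T z
  obtain ⟨T', π, hπ, x, hx⟩ := ex.exact_up_to_refinements (z ≫ V.map b) (by
    change (z ≫ V.map b) ≫ V.map (R.cocomplex.d 1 2) = 0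
    rw [Category.assoc, ← V.map_comp, hbd]; simp)
  refine ⟨T', π, hπ, pb.lift x (π ≫ z) ?_, (pb.lift_snd _ _ _).symm⟩
  rw [Category.assoc]
  exact hx.symm
end


section
variable {B : Type*} [Category* B] [Abelian B]
variable [EnoughInjectives B] {C : Type*} [Category* C] [Abelian C]
  (V : B ⥤ C) [V.Additive] [PreservesFiniteLimits V]

lemma gss_cyc_zero (N : CochainComplex B ℤ) (i j : ℤ) :
    N.iCycles i ≫ N.toCycles i j = 0 := by
  rw [← cancel_mono (N.iCycles j)]; simp

lemma gss_cyc (N : CochainComplex B ℤ) (hN : N.Acyclic) (i j : ℤ) (h : i + 1 = j) :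
    (ShortComplex.mk (N.iCycles i) (N.toCycles i j) (gss_cyc_zero N i j)).ShortExact where
  exact := by
    have ex : (ShortComplex.mk (N.iCycles i) (N.d i j) (by simp)).Exact :=
      ShortComplex.exact_of_f_is_kernel _ (N.cyclesIsKernel i j (by simp; lia))
    let φ : ShortComplex.mk (N.iCycles i) (N.toCycles i j) (gss_cyc_zero N i j) ⟶
      ShortComplex.mk (N.iCycles i) (N.d i j) (by simp) :=
      { τ₁ := 𝟙 _, τ₂ := 𝟙 _, τ₃ := N.iCycles j }
    have : Epi φ.τ₁ := inferInstanceAs (Epi (𝟙 _))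
    have : IsIso φ.τ₂ := inferInstanceAs (IsIso (𝟙 _))
    have : Mono φ.τ₃ := inferInstanceAs (Mono (N.iCycles j))
    exact (ShortComplex.exact_iff_of_epi_of_isIso_of_mono φ).2 ex
  mono_f := inferInstanceAs (Mono (N.iCycles i))
  epi_g := by
    change Epi (N.toCycles i j)
    rw [epi_iff_surjective_up_to_refinements]
    intro T z
    have ex := (HomologicalComplex.exactAt_iff' N i j (j + 1) (by simp; lia) (by simp)).1 (hN j)
    obtain ⟨T', π, hπ, x, hx⟩ := ex.exact_up_to_refinements (z ≫ N.iCycles j)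
      ((Category.assoc _ _ _).trans ((congrArg (fun y => z ≫ y) (N.iCycles_d j (j + 1))).trans comp_zero))
    refine ⟨T', π, hπ, x, ?_⟩
    rw [← cancel_mono (N.iCycles j)]
    refine (Category.assoc _ _ _).trans (hx.trans ?_)
    refine Eq.trans ?_ (Category.assoc _ _ _).symm
    exact congrArg (fun z => x ≫ z) (N.toCycles_i i j).symm

variable [HasDerivedCategory B]

lemma gss_rd_iff (M : B) (q : ℕ) : IsZero ((V.rightDerived q).obj M) ↔
    IsZero ((DerivedCategory.Plus.singleFunctor B 0 ⋙ gssH V q).obj M) :=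
  (gssH_single_zero V M q).some.symm.isZero_iff

lemma gss_acyclic (N : CochainComplex B ℤ) (hN : N.Acyclic) (m : ℤ) [N.IsStrictlyGE m]
    (h : ∀ (i : ℤ) (q : ℕ), 0 < q → IsZero ((V.rightDerived q).obj (N.X i))) :
    ((V.mapHomologicalComplex (ComplexShape.up ℤ)).obj N).Acyclic := by
  have h0 : ∀ (k : ℕ) (q : ℕ), 0 < q → IsZero ((V.rightDerived q).obj (N.cycles (m + k))) := by
    intro k
    induction k with
    | zero =>
      intro q hq
      rw [gss_rd_iff]
      apply Functor.map_isZero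
      have := (gss_cyc N hN (m - 1) (m + (0 : ℕ)) (by simp)).epi_g
      exact IsZero.of_epi (N.toCycles (m - 1) (m + (0 : ℕ)))
        (N.isZero_of_isStrictlyGE m _ (by lia))
    | succ k ih =>
      intro q hq
      exact gss_dimshift V _ (gss_cyc N hN (m + k) (m + (k + 1 : ℕ)) (by push_cast; ring)) q
        (h _ q hq) (ih (q + 1) (by lia))
  have h1 : ∀ (i : ℤ), IsZero ((V.rightDerived 1).obj (N.cycles i)) := by
    intro i
    by_cases hi : m ≤ i
    · obtain ⟨k, rfl⟩ := Int.le.dest hi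
      exact h0 k 1 (by lia)
    · rw [gss_rd_iff]
      apply Functor.map_isZero
      exact IsZero.of_mono (N.iCycles i) (N.isZero_of_isStrictlyGE m _ (by lia))
  intro j
  rw [HomologicalComplex.exactAt_iff' _ (j - 1) j (j + 1) (by simp) (by simp)]
  have hepi : Epi (V.map (N.toCycles (j - 1) j)) :=
    gss_epi V _ (gss_cyc N hN (j - 1) j (by lia)) (h1 _)
  have ex : (ShortComplex.mk (N.iCycles j) (N.d j (j + 1)) (by simp)).Exact :=
      ShortComplex.exact_of_f_is_kernel _ (N.cyclesIsKernel j (j + 1) (by simp))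
  have ex' := ex.map_of_mono_of_preservesKernel V (inferInstanceAs (Mono (N.iCycles j)))
    inferInstance
  let φ : ((V.mapHomologicalComplex (ComplexShape.up ℤ)).obj N).sc' (j - 1) j (j + 1) ⟶
    (ShortComplex.mk (N.iCycles j) (N.d j (j + 1)) (by simp)).map V :=
    { τ₁ := V.map (N.toCycles (j - 1) j), τ₂ := 𝟙 _, τ₃ := 𝟙 _
      comm₁₂ := by
        change V.map (N.toCycles (j - 1) j) ≫ V.map (N.iCycles j) = V.map (N.d (j - 1) j) ≫ 𝟙 _
        rw [← V.map_comp]; simp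
      comm₂₃ := (Category.id_comp _).trans (Category.comp_id _).symm }
  have : Epi φ.τ₁ := hepi
  have : IsIso φ.τ₂ := inferInstanceAs (IsIso (𝟙 _))
  have : Mono φ.τ₃ := inferInstanceAs (Mono (𝟙 _))
  exact (ShortComplex.exact_iff_of_epi_of_isIso_of_mono φ).2 ex'

lemma gss_acyclic_iff {D : Type*} [Category* D] [Abelian D] {K L : CochainComplex D ℤ} (f : K ⟶ L) :
    QuasiIso f ↔ (CochainComplex.mappingCone f).Acyclic := by
  rw [← HomotopyCategory.quotient_obj_mem_subcategoryAcyclic_iff_acyclic,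
    ← HomologicalComplex.mem_quasiIso_iff, ← HomotopyCategory.quotient_map_mem_quasiIso_iff,
    HomotopyCategory.quasiIso_eq_trW_subcategoryAcyclic]
  exact (HomotopyCategory.subcategoryAcyclic D).trW_iff_of_distinguished _
    (HomotopyCategory.mappingCone_triangleh_distinguished f)

lemma gss_key {K L : CochainComplex B ℤ} (f : K ⟶ L) {D : Type*} [Category* D] [Abelian D]
    (F : B ⥤ D) [F.Additive] (i : ℤ)
    (h1 : IsZero (F.obj (K.X (i + 1)))) (h2 : IsZero (F.obj (L.X i))) :
    IsZero (F.obj ((CochainComplex.mappingCone f).X i)) := by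
  rw [IsZero.iff_id_eq_zero, ← F.map_id,
    ← CochainComplex.mappingCone.id_X f i (i + 1) rfl, F.map_add, F.map_comp, F.map_comp,
    h1.eq_of_tgt (F.map _) 0, h2.eq_of_tgt (F.map _) 0]
  simp

lemma gss_quasiIso {K L : CochainComplex B ℤ} (f : K ⟶ L) [QuasiIso f] (m : ℤ)
    [K.IsStrictlyGE m] [L.IsStrictlyGE m]
    (hK : ∀ (i : ℤ) (q : ℕ), 0 < q → IsZero ((V.rightDerived q).obj (K.X i)))
    (hL : ∀ (i : ℤ) (q : ℕ), 0 < q → IsZero ((V.rightDerived q).obj (L.X i))) :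
    QuasiIso ((V.mapHomologicalComplex (ComplexShape.up ℤ)).map f) := by
  rw [gss_acyclic_iff]
  have : (CochainComplex.mappingCone f).IsStrictlyGE (m - 1) := by
    rw [CochainComplex.isStrictlyGE_iff]
    intro i hi
    exact gss_key f (𝟭 B) i (K.isZero_of_isStrictlyGE m _ (by lia)) (L.isZero_of_isStrictlyGE m _ (by lia))
  have h := gss_acyclic V (CochainComplex.mappingCone f) ((gss_acyclic_iff f).1 inferInstance)
    (m - 1) (fun i q hq => (gss_rd_iff V _ q).2
      (gss_key f _ i ((gss_rd_iff V _ q).1 (hK _ q hq)) ((gss_rd_iff V _ q).1 (hL _ q hq))))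
  exact fun i => (h i).of_iso (CochainComplex.mappingCone.mapHomologicalComplexIso f V)
end


open DerivedCategory in
/-- Grothendieck spectral sequence. The total right derived functors
`RW`, `RV`, `RVW` of `W`, `V` and `W ⋙ V` on the (bounded-below part of the) derived
categories are taken in the sense of Mathlib's `Functor.IsRightDerivedFunctor`, i.e. as left
Kan extensions of `K ↦ Q((−).mapHomologicalComplex)` along the localization functor `Q` at
the quasi-isomorphisms; `R^pV` on objects is the classical right derived functor computed by
injective resolutions. -/
theorem grothendieck_spectral_sequence
    {A : Type u₁} {B : Type u₂} {C : Type u₃}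
    [Category.{v₁} A] [Category.{v₂} B] [Category.{v₃} C]
    [Abelian A] [Abelian B] [Abelian C] [EnoughInjectives A] [EnoughInjectives B]
    [HasDerivedCategory A] [HasDerivedCategory B] [HasDerivedCategory C]
    (W : A ⥤ B) (V : B ⥤ C) [W.Additive] [V.Additive]
    [PreservesFiniteLimits W] [PreservesFiniteLimits V]
    -- `W` sends injective objects to `V`-acyclic objects
    (hacyclic : ∀ I : A, Injective I → ∀ q : ℕ, 0 < q → IsZero ((V.rightDerived q).obj (W.obj I)))
    -- the total right derived functor of `W`
    (RW : DerivedCategory A ⥤ DerivedCategory B)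
    (αW : W.mapHomologicalComplex (ComplexShape.up ℤ) ⋙ DerivedCategory.Q ⟶
      DerivedCategory.Q ⋙ RW)
    [RW.IsRightDerivedFunctor αW (HomologicalComplex.quasiIso A (ComplexShape.up ℤ))]
    -- the total right derived functor of `V`
    (RV : DerivedCategory B ⥤ DerivedCategory C)
    (αV : V.mapHomologicalComplex (ComplexShape.up ℤ) ⋙ DerivedCategory.Q ⟶
      DerivedCategory.Q ⋙ RV)
    [RV.IsRightDerivedFunctor αV (HomologicalComplex.quasiIso B (ComplexShape.up ℤ))]
    -- the total right derived functor of the composite `VW = W ⋙ V`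
    (RVW : DerivedCategory A ⥤ DerivedCategory C)
    (αVW : (W ⋙ V).mapHomologicalComplex (ComplexShape.up ℤ) ⋙ DerivedCategory.Q ⟶
      DerivedCategory.Q ⋙ RVW)
    [RVW.IsRightDerivedFunctor αVW (HomologicalComplex.quasiIso A (ComplexShape.up ℤ))]
    -- a bounded-below complex `X` in `A`
    (X : CochainComplex A ℤ) (hX : ∃ m : ℤ, ∀ i : ℤ, i < m → IsZero (X.X i)) :
    -- `R(VW)(X) ≅ RV(RW(X))`
    Nonempty (RVW.obj (DerivedCategory.Q.obj X) ≅ RV.obj (RW.obj (DerivedCategory.Q.obj X))) ∧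
    -- the Grothendieck spectral sequence `E_2^{p,q} = R^pV(R^qW(X)) ⇒ R^{p+q}(VW)(X)`
    ∃ S : ConvergingCohomSS C,
      (∀ p q : ℤ, 0 ≤ p → Nonempty (S.E 2 p q ≅
        (V.rightDerived p.toNat).obj
          ((DerivedCategory.homologyFunctor B q).obj (RW.obj (DerivedCategory.Q.obj X))))) ∧
      (∀ p q : ℤ, p < 0 → IsZero (S.E 2 p q)) ∧
      (∀ n : ℤ, Nonempty (S.H n ≅
        (DerivedCategory.homologyFunctor C n).obj (RVW.obj (DerivedCategory.Q.obj X)))) := by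
  obtain ⟨m, hm⟩ := hX
  have hXm : X.IsStrictlyGE m := by
    rw [CochainComplex.isStrictlyGE_iff]
    exact hm
  let X' : CochainComplex.Plus A := ⟨X, m, hXm⟩
  have : X'.obj.IsStrictlyGE m := hXm
  obtain ⟨I, hI, i, hi⟩ := CochainComplex.Plus.exists_quasiIso_injective X' m
  have hi' : QuasiIso i.hom := hi
  let I' := ((InjectiveObject.ι A).mapCochainComplexPlus.obj I).obj
  let WI : CochainComplex B ℤ := (W.mapHomologicalComplex (ComplexShape.up ℤ)).obj I'
  have hWI : WI.IsStrictlyGE m := by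
    rw [CochainComplex.isStrictlyGE_iff]
    intro k hk
    have h1 : IsZero (I.obj.X k) := I.obj.isZero_of_isStrictlyGE m k hk
    exact W.map_isZero ((InjectiveObject.ι A).map_isZero h1)
  let WI' : CochainComplex.Plus B := ⟨WI, m, hWI⟩
  have : WI'.obj.IsStrictlyGE m := hWI
  obtain ⟨J, hJ, j, hj⟩ := CochainComplex.Plus.exists_quasiIso_injective WI' m
  have hj' : QuasiIso j.hom := hj
  let J' := ((InjectiveObject.ι B).mapCochainComplexPlus.obj J).obj
  have hJ' : J'.IsStrictlyGE m := by
    rw [CochainComplex.isStrictlyGE_iff]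
    intro k hk
    have h1 : IsZero (J.obj.X k) := J.obj.isZero_of_isStrictlyGE m k hk
    exact (InjectiveObject.ι B).map_isZero h1
  have hVj : QuasiIso ((V.mapHomologicalComplex (ComplexShape.up ℤ)).map j.hom) := by
    refine @gss_quasiIso _ _ _ _ _ _ _ V _ _ _ WI J' j.hom hj' m hWI hJ' ?_ ?_
    · intro k q hq
      exact hacyclic _ (I.obj.X k).property q hq
    · intro k q hq
      obtain ⟨q, rfl⟩ : ∃ q', q = q' + 1 := ⟨q - 1, by lia⟩
      have : Injective (J'.X k) := (J.obj.X k).property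
      exact V.isZero_rightDerived_obj_injective_succ q (J'.X k)
  have u1 : IsIso (αW.app I') := gss_isIso_unit W RW αW I
  have u2 : IsIso (αV.app J') := gss_isIso_unit V RV αV J
  have u3 : IsIso (αVW.app I') := gss_isIso_unit (W ⋙ V) RVW αVW I
  let eX : Q.obj X ≅ Q.obj I' := asIso (Q.map i.hom)
  let eJ : Q.obj WI ≅ Q.obj J' := asIso (Q.map j.hom)
  let eVJ : Q.obj ((V.mapHomologicalComplex (ComplexShape.up ℤ)).obj WI) ≅
      Q.obj ((V.mapHomologicalComplex (ComplexShape.up ℤ)).obj J') :=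
    asIso (Q.map ((V.mapHomologicalComplex (ComplexShape.up ℤ)).map j.hom))
  let aW : Q.obj WI ≅ RW.obj (Q.obj I') := asIso (αW.app I')
  let aV : Q.obj ((V.mapHomologicalComplex (ComplexShape.up ℤ)).obj J') ≅ RV.obj (Q.obj J') :=
    asIso (αV.app J')
  let aVW : Q.obj ((V.mapHomologicalComplex (ComplexShape.up ℤ)).obj WI) ≅
      RVW.obj (Q.obj I') := @asIso _ _ _ _ (αVW.app I') u3
  let e1 : RVW.obj (Q.obj X) ≅ Q.obj ((V.mapHomologicalComplex (ComplexShape.up ℤ)).obj J') :=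
    RVW.mapIso eX ≪≫ aVW.symm ≪≫ eVJ
  let e2 : RW.obj (Q.obj X) ≅ Q.obj J' := RW.mapIso eX ≪≫ aW.symm ≪≫ eJ
  refine ⟨⟨e1 ≪≫ aV ≪≫ RV.mapIso e2.symm⟩, ?_⟩
  let K : Plus B := Plus.Q.obj ((InjectiveObject.ι B).mapCochainComplexPlus.obj J)
  let eK : Plus.ι.obj K ≅ Q.obj J' :=
    gssιQ.app ((InjectiveObject.ι B).mapCochainComplexPlus.obj J)
  have hK : K.IsGE m := by
    rw [← Plus.isGE_ι_obj_iff]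
    exact TStructure.t.isGE_of_iso eK.symm m
  obtain ⟨S, h1, h2, h3⟩ := gss_final V K m
  refine ⟨S, fun p q hp => ?_, h2, fun n => ?_⟩
  · obtain ⟨e⟩ := h1 p q hp
    let e' : (Plus.homologyFunctor B q).obj K ≅
        (homologyFunctor B q).obj (RW.obj (Q.obj X)) :=
      (homologyFunctor B q).mapIso (eK ≪≫ e2.symm)
    exact ⟨e ≪≫ (V.rightDerived p.toNat).mapIso e'⟩
  · obtain ⟨e⟩ := h3 n
    exact ⟨e ≪≫ gssHObjIso V J n ≪≫ ((homologyFunctorFactors C n).symm.app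
      ((V.mapHomologicalComplex (ComplexShape.up ℤ)).obj J')) ≪≫
      (homologyFunctor C n).mapIso e1.symm⟩
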